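/- arXiv:1508.03185 — 3 statements merged into one kernel-verified Lean document; each statement's English description precedes it below -/
import Mathlib

section
/- Let n be a positive integer, let A₁,…,A_{n+3} be n+3 points in general position in ℝⁿ, and let x̂ = (x̂₁,…,x̂_{n+3}) be a nonzero vector of real numbers satisfying ∑ᵢ x̂ᵢ Aᵢ = 0 and ∑ᵢ x̂ᵢ = 0. Then there is a point lying in the intrinsic interior of the convex hull of {Aᵢ : x̂ᵢ > 0} and simultaneously in the intrinsic interior of the convex hull of {Aᵢ : x̂ᵢ < 0}. -/
open Filter Topology in
/-- For nonnegative weights `w`, any weights `v` supported in the support of `w` can be scaled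
by a factor in `(0, 1)` so as to lie below `w`. -/
theorem exists_mul_le_of_support {ι : Type*} [Finite ι] {v w : ι → ℝ} (hw : ∀ i, 0 ≤ w i)
    (hvw : ∀ i, w i = 0 → v i = 0) : ∃ ε : ℝ, 0 < ε ∧ ε < 1 ∧ ∀ i, ε * v i ≤ w i := by
  have hall : ∀ᶠ ε : ℝ in 𝓝[>] 0, ∀ i, ε * v i ≤ w i := by
    refine eventually_all.2 fun i => ?_
    rcases (hw i).eq_or_lt with h | h
    · simp [hvw i h.symm, ← h]
    · have ht : Tendsto (fun ε : ℝ => ε * v i) (𝓝 0) (𝓝 (0 * v i)) :=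
        (continuous_id.mul continuous_const).tendsto 0
      rw [zero_mul] at ht
      exact nhdsWithin_le_nhds ((ht.eventually_lt_const h).mono fun _ => le_of_lt)
  have hlt : ∀ᶠ ε : ℝ in 𝓝[>] 0, ε < 1 := nhdsWithin_le_nhds (gt_mem_nhds one_pos)
  obtain ⟨ε, hε, hε1, hε0⟩ := (hall.and (hlt.and self_mem_nhdsWithin)).exists
  exact ⟨ε, hε0, hε1, hε⟩

theorem exists_weights_of_mem_convexHull_image {ι E : Type*} [Fintype ι] [AddCommGroup E]
    [Module ℝ E] {A : ι → E} {s : Set ι} {q : E} (hq : q ∈ convexHull ℝ (A '' s)) :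
    ∃ v : ι → ℝ, (∀ i, 0 ≤ v i) ∧ ∑ i, v i = 1 ∧ (∀ i ∉ s, v i = 0) ∧ ∑ i, v i • A i = q := by
  classical
  refine convexHull_min (t := {q | ∃ v : ι → ℝ, (∀ i, 0 ≤ v i) ∧ ∑ i, v i = 1 ∧
    (∀ i ∉ s, v i = 0) ∧ ∑ i, v i • A i = q}) ?_ ?_ hq
  · rintro _ ⟨j, hj, rfl⟩
    refine ⟨Pi.single j 1, fun i => ?_, by simp, fun i hi => ?_, by simp [Pi.single_apply]⟩
    · by_cases h : i = j <;> simp [h]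
    · exact Pi.single_eq_of_ne (fun h : i = j => hi (h ▸ hj)) _
  · rintro _ ⟨u, hu0, hu1, hus, rfl⟩ _ ⟨v, hv0, hv1, hvs, rfl⟩ a b ha hb hab
    refine ⟨fun i => a * u i + b * v i, fun i => ?_, ?_, fun i hi => ?_, ?_⟩
    · have := hu0 i
      have := hv0 i
      positivity
    · simp [Finset.sum_add_distrib, ← Finset.mul_sum, hu1, hv1, hab]
    · simp [hus i hi, hvs i hi]
    · simp [add_smul, mul_smul, Finset.sum_add_distrib, Finset.smul_sum]

/-- A convex combination of a point of a convex set and a point of its intrinsic interior,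
with positive weight on the latter, lies in the intrinsic interior. -/
theorem Convex.combo_self_intrinsicInterior_mem {E : Type*} [NormedAddCommGroup E]
    [NormedSpace ℝ E] {s : Set E} (hs : Convex ℝ s) {r q : E} (hr : r ∈ s)
    (hq : q ∈ intrinsicInterior ℝ s) {a b : ℝ} (ha : 0 ≤ a) (hb : 0 < b) (hab : a + b = 1) :
    a • r + b • q ∈ intrinsicInterior ℝ s := by
  have hqs : q ∈ s := intrinsicInterior_subset hq
  have hps : a • r + b • q ∈ s := hs hr hqs ha hb.le hab
  obtain ⟨q', hq', rfl⟩ := mem_intrinsicInterior.1 hq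
  obtain ⟨δ, hδ, hball⟩ := Metric.mem_nhds_iff.1 (mem_interior_iff_mem_nhds.1 hq')
  refine mem_intrinsicInterior.2 ⟨⟨_, subset_affineSpan ℝ s hps⟩, ?_, rfl⟩
  refine mem_interior_iff_mem_nhds.2 (Metric.mem_nhds_iff.2 ⟨b * δ, by positivity, ?_⟩)
  rintro ⟨y, hy⟩ hyb
  have hz : b⁻¹ • (y - (a • r + b • (q' : E))) + q' ∈ affineSpan ℝ s :=
    (affineSpan ℝ s).smul_vsub_vadd_mem b⁻¹ hy (subset_affineSpan ℝ s hps) q'.2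
  have hzs : b⁻¹ • (y - (a • r + b • (q' : E))) + q' ∈ s := by
    refine hball (a := ⟨_, hz⟩) ?_
    rw [Metric.mem_ball, Subtype.dist_eq, dist_eq_norm] at hyb ⊢
    rw [add_sub_cancel_right, norm_smul, norm_inv, Real.norm_of_nonneg hb.le]
    exact (inv_mul_lt_iff₀ hb).2 hyb
  have h := hs hr hzs ha hb.le hab
  rw [smul_add, smul_inv_smul₀ hb.ne'] at h
  have heq : a • r + (y - (a • r + b • (q' : E)) + b • (q' : E)) = y := by abel
  rwa [heq] at h

/-- A convex combination of finitely many points lies in the intrinsic interior of the convex hull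
of the points that have positive weight. -/
theorem sum_smul_mem_intrinsicInterior_convexHull {ι E : Type*} [Fintype ι]
    [NormedAddCommGroup E] [NormedSpace ℝ E] [FiniteDimensional ℝ E] (A : ι → E) {w : ι → ℝ}
    (hw0 : ∀ i, 0 ≤ w i) (hw1 : ∑ i, w i = 1) :
    ∑ i, w i • A i ∈ intrinsicInterior ℝ (convexHull ℝ (A '' {i | 0 < w i})) := by
  have hconv := convex_convexHull ℝ (A '' {i | 0 < w i})
  have hne : (convexHull ℝ (A '' {i | 0 < w i})).Nonempty := by
    obtain ⟨i, -, hi⟩ := Finset.exists_lt_of_sum_lt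
      (s := Finset.univ) (f := fun _ => (0 : ℝ)) (g := w) (by simp [hw1])
    exact ⟨A i, subset_convexHull ℝ _ ⟨i, hi, rfl⟩⟩
  obtain ⟨q, hq⟩ := hne.intrinsicInterior hconv
  obtain ⟨v, -, hv1, hvs, hvq⟩ :=
    exists_weights_of_mem_convexHull_image (intrinsicInterior_subset hq)
  obtain ⟨ε, hε0, hε1, hε⟩ := exists_mul_le_of_support hw0 (v := v) fun i hi => hvs i (by simp [hi])
  have hpos : 0 < 1 - ε := sub_pos.2 hε1
  have hzero : ∀ i, ¬ 0 < w i → (1 - ε)⁻¹ * (w i - ε * v i) = 0 := fun i hi => by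
    simp [hvs i hi, le_antisymm (not_lt.1 hi) (hw0 i)]
  have hr : ∑ i, ((1 - ε)⁻¹ * (w i - ε * v i)) • A i ∈ convexHull ℝ (A '' {i | 0 < w i}) := by
    classical
    rw [← Finset.sum_filter_of_ne (p := fun i => 0 < w i) fun i _ =>
      not_imp_comm.1 fun hi => by rw [hzero i hi, zero_smul]]
    refine hconv.sum_mem (fun i _ => mul_nonneg (inv_nonneg.2 hpos.le) (sub_nonneg.2 (hε i))) ?_
      fun i hi => subset_convexHull ℝ _ ⟨i, (Finset.mem_filter.1 hi).2, rfl⟩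
    rw [Finset.sum_filter_of_ne fun i _ hi => not_not.1 (mt (hzero i) hi), ← Finset.mul_sum,
      Finset.sum_sub_distrib, ← Finset.mul_sum, hw1, hv1, mul_one, inv_mul_cancel₀ hpos.ne']
  have h := hconv.combo_self_intrinsicInterior_mem hr hq hpos.le hε0 (by ring)
  convert h using 1
  rw [← hvq, Finset.smul_sum, Finset.smul_sum, ← Finset.sum_add_distrib]
  refine Finset.sum_congr rfl fun i _ => ?_
  rw [smul_smul, smul_smul, mul_inv_cancel_left₀ hpos.ne', ← add_smul, sub_add_cancel]

/-- Main lemma: if `x̂ ≠ 0` satisfies `∑ x̂ᵢ Aᵢ = 0` and `∑ x̂ᵢ = 0` for points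
`A₁, …, A_{n+3}` in general position in ℝⁿ, then the intrinsic interiors of the
convex hulls of `{Aᵢ : x̂ᵢ > 0}` and `{Aᵢ : x̂ᵢ < 0}` have a common point. -/
theorem interiors_meet_of_solution
    (n : ℕ) (hn : 0 < n)
    (A : Fin (n + 3) → EuclideanSpace ℝ (Fin n))
    (hgen : ∀ s : Finset (Fin (n + 3)), s.card = n + 1 →
      AffineIndependent ℝ (fun i : s => A i))
    (x : Fin (n + 3) → ℝ) (hx : x ≠ 0)
    (hsum : ∑ i, x i • A i = 0) (hsum1 : ∑ i, x i = 0) :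
    ∃ p : EuclideanSpace ℝ (Fin n),
      p ∈ intrinsicInterior ℝ (convexHull ℝ (A '' {i | 0 < x i})) ∧
      p ∈ intrinsicInterior ℝ (convexHull ℝ (A '' {i | x i < 0})) := by
  have hdiff : ∀ i, (x i)⁺ - (x i)⁻ = x i := fun i => posPart_sub_negPart (x i)
  have hS : ∑ i, (x i)⁻ = ∑ i, (x i)⁺ := by
    rw [eq_comm, ← sub_eq_zero, ← Finset.sum_sub_distrib]
    simpa only [hdiff] using hsum1
  have hA : ∑ i, (x i)⁻ • A i = ∑ i, (x i)⁺ • A i := by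
    rw [eq_comm, ← sub_eq_zero, ← Finset.sum_sub_distrib]
    simpa only [← sub_smul, hdiff] using hsum
  have hpos : 0 < ∑ i, (x i)⁺ := by
    refine (Finset.sum_nonneg fun i _ => posPart_nonneg (x i)).lt_of_ne' fun h => hx ?_
    have hp := (Finset.sum_eq_zero_iff_of_nonneg fun i _ => posPart_nonneg (x i)).1 h
    have hm := (Finset.sum_eq_zero_iff_of_nonneg fun i _ => negPart_nonneg (x i)).1 (hS.trans h)
    funext i
    rw [← hdiff i, hp i (Finset.mem_univ i), hm i (Finset.mem_univ i), sub_zero, Pi.zero_apply]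
  have hinv := inv_pos.2 hpos
  have hplus := sum_smul_mem_intrinsicInterior_convexHull A
    (w := fun i => (∑ j, (x j)⁺)⁻¹ * (x i)⁺)
    (fun i => mul_nonneg hinv.le (posPart_nonneg _))
    (by rw [← Finset.mul_sum, inv_mul_cancel₀ hpos.ne'])
  have hminus := sum_smul_mem_intrinsicInterior_convexHull A
    (w := fun i => (∑ j, (x j)⁺)⁻¹ * (x i)⁻)
    (fun i => mul_nonneg hinv.le (negPart_nonneg _))
    (by rw [← Finset.mul_sum, hS, inv_mul_cancel₀ hpos.ne'])
  simp only [mul_pos_iff_of_pos_left hinv, posPart_pos_iff, negPart_pos_iff, mul_smul,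
    ← Finset.smul_sum, hA] at hplus hminus
  exact ⟨_, hplus, hminus⟩
end

section
/- Let n be an odd positive integer and let A₁,…,A_{n+3} be n+3 points in general position in ℝⁿ. Then there exist nonzero vectors x¹, x² ∈ ℝ^{n+3}, each satisfying ∑ᵢ xᵢ Aᵢ = 0 and ∑ᵢ xᵢ = 0, such that x¹ has exactly (n+3)/2 strictly positive and (n+1)/2 strictly negative coordinates, x² has exactly (n+1)/2 strictly positive and (n+3)/2 strictly negative coordinates, the set of indices where x¹ is negative is contained in the set of indices where x² is negative, and the set of indices where x² is positive is contained in the set of indices where x¹ is positive. -/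
open Finset in
/-- If a vector has `i` as its only zero coordinate, then its positive and negative
coordinates together are all but one of the coordinates. -/
theorem card_pos_add_card_neg {ι : Type*} [Fintype ι] {x : ι → ℝ} {i : ι}
    (hx : ∀ k, x k = 0 ↔ k = i) :
    #{k | 0 < x k} + #{k | x k < 0} + 1 = Fintype.card ι := by
  classical
  have hdisj : Disjoint ({k | 0 < x k} : Finset ι) ({k | x k < 0} : Finset ι) := by
    rw [disjoint_filter]
    intro k _ h
    exact h.le.not_gt
  have hunion : ({k | 0 < x k} : Finset ι) ∪ ({k | x k < 0} : Finset ι) = univ.erase i := by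
    ext k
    simp only [mem_union, mem_filter, mem_univ, true_and, mem_erase, and_true, ne_eq, ← hx k]
    rw [or_comm, lt_or_lt_iff_ne]
  rw [← card_union_of_disjoint hdisj, hunion, card_erase_add_one (mem_univ i), card_univ]

open Finset in
/-- Among pairs of vectors of `K` vanishing at distinct indices, the first with a positive and the
second with a negative majority of coordinates, there is one without opposite signs. -/
theorem exists_sign_compatible_pair {ι : Type*} [Fintype ι] (K : Submodule ℝ (ι → ℝ))
    (hK : ∀ x ∈ K, x ≠ 0 → ∀ i j, x i = 0 → x j = 0 → i = j) (heven : Even (Fintype.card ι))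
    {x y : ι → ℝ} {i j : ι} (hx : x ∈ K) (hy : y ∈ K) (hx0 : x ≠ 0) (hy0 : y ≠ 0) (hij : i ≠ j)
    (hxi : x i = 0) (hyj : y j = 0)
    (hxs : #{k | x k < 0} < #{k | 0 < x k}) (hys : #{k | 0 < y k} < #{k | y k < 0}) :
    ∃ x ∈ K, ∃ y ∈ K, ∃ i j, x ≠ 0 ∧ y ≠ 0 ∧ i ≠ j ∧ x i = 0 ∧ y j = 0 ∧
      #{k | x k < 0} < #{k | 0 < x k} ∧ #{k | 0 < y k} < #{k | y k < 0} ∧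
      ∀ k, 0 ≤ x k * y k := by
  induction hc : #{k | x k * y k < 0} using Nat.strong_induction_on generalizing x y i j with
  | _ c ih =>
  by_cases hopp : ∀ k, 0 ≤ x k * y k
  · exact ⟨x, hx, y, hy, i, j, hx0, hy0, hij, hxi, hyj, hxs, hys, hopp⟩
  push Not at hopp
  obtain ⟨l, hl⟩ := hopp
  have hxl : x l ≠ 0 := by rintro h; simp [h] at hl
  have hyl : y l ≠ 0 := by rintro h; simp [h] at hl
  have hli : l ≠ i := by rintro rfl; exact hxl hxi
  have hlj : l ≠ j := by rintro rfl; exact hyl hyj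
  set z : ι → ℝ := |y l| • x + |x l| • y with hz
  have hzk (k) : z k = |y l| * x k + |x l| * y k := by simp [hz]
  have hzK : z ∈ K := K.add_mem (K.smul_mem _ hx) (K.smul_mem _ hy)
  have hzl : z l = 0 := by
    rw [hzk]
    rcases mul_neg_iff.1 hl with ⟨h1, h2⟩ | ⟨h1, h2⟩
    · rw [abs_of_pos h1, abs_of_neg h2]; ring
    · rw [abs_of_neg h1, abs_of_pos h2]; ring
  have hz0 : z ≠ 0 := by
    intro h
    have hzi : |x l| * y i = 0 := by simpa [hxi, h] using (hzk i).symm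
    rcases mul_eq_zero.1 hzi with h' | h'
    · exact hxl (abs_eq_zero.1 h')
    · exact hij (hK y hy hy0 i j h' hyj)
  have hcard := card_pos_add_card_neg (x := z) (i := l)
    fun k => ⟨fun h => hK z hzK hz0 k l h hzl, fun h => h ▸ hzl⟩
  have hay : 0 < |y l| := abs_pos.2 hyl
  have hax : 0 < |x l| := abs_pos.2 hxl
  rcases lt_trichotomy #{k | z k < 0} #{k | 0 < z k} with h | h | h
  · refine ih _ ?_ hzK hy hz0 hy0 hlj hzl hyj h hys rfl
    rw [← hc]
    refine card_lt_card (ssubset_iff_of_subset ?_ |>.2 ⟨l, by simpa using hl, by simp [hzl]⟩)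
    intro k hk
    simp only [mem_filter, mem_univ, true_and, hzk] at hk ⊢
    nlinarith [mul_nonneg hax.le (mul_self_nonneg (y k))]
  · rw [h] at hcard
    obtain ⟨m, hm⟩ := heven
    omega
  · refine ih _ ?_ hx hzK hx0 hz0 hli.symm hxi hzl hxs h rfl
    rw [← hc]
    refine card_lt_card (ssubset_iff_of_subset ?_ |>.2 ⟨l, by simpa using hl, by simp [hzl]⟩)
    intro k hk
    simp only [mem_filter, mem_univ, true_and, hzk] at hk ⊢
    nlinarith [mul_nonneg hay.le (mul_self_nonneg (x k))]

open Finset in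
/-- Two vectors without opposite signs, each with a single zero coordinate, at distinct indices,
one with a positive and one with a negative majority, are adjacent and almost balanced. -/
theorem card_signs_of_sign_compatible {ι : Type*} [Fintype ι] (heven : Even (Fintype.card ι))
    {x y : ι → ℝ} {i j : ι} (hij : i ≠ j)
    (hx : ∀ k, x k = 0 ↔ k = i) (hy : ∀ k, y k = 0 ↔ k = j)
    (hxs : #{k | x k < 0} < #{k | 0 < x k}) (hys : #{k | 0 < y k} < #{k | y k < 0})
    (hxy : ∀ k, 0 ≤ x k * y k) :
    #{k | 0 < x k} = Fintype.card ι / 2 ∧ #{k | x k < 0} = Fintype.card ι / 2 - 1 ∧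
      #{k | 0 < y k} = Fintype.card ι / 2 - 1 ∧ #{k | y k < 0} = Fintype.card ι / 2 ∧
      {k | x k < 0} ⊆ {k | y k < 0} ∧ {k | 0 < y k} ⊆ {k | 0 < x k} := by
  classical
  have hneg (k) (hki : k ≠ i) (hkj : k ≠ j) : x k < 0 ↔ y k < 0 := by
    have h1 : x k ≠ 0 := fun h => hki ((hx k).1 h)
    have h2 : y k ≠ 0 := fun h => hkj ((hy k).1 h)
    constructor
    · intro h; exact lt_of_le_of_ne (nonpos_of_mul_nonneg_right (hxy k) h) h2
    · intro h; exact lt_of_le_of_ne (nonpos_of_mul_nonneg_left (hxy k) h) h1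
  have hpos (k) (hki : k ≠ i) (hkj : k ≠ j) : 0 < x k ↔ 0 < y k := by
    have h1 : x k ≠ 0 := fun h => hki ((hx k).1 h)
    have h2 : y k ≠ 0 := fun h => hkj ((hy k).1 h)
    have := hneg k hki hkj
    grind
  have hxi : x i = 0 := (hx i).2 rfl
  have hyj : y j = 0 := (hy j).2 rfl
  have hxj : x j ≠ 0 := fun h => hij ((hx j).1 h).symm
  have hyi : y i ≠ 0 := fun h => hij ((hy i).1 h)
  have hP : ({k | 0 < x k} : Finset ι).erase j = ({k | 0 < y k} : Finset ι).erase i := by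
    ext k
    simp only [mem_erase, mem_filter, mem_univ, true_and]
    have := hpos k
    grind
  have hN : ({k | x k < 0} : Finset ι).erase j = ({k | y k < 0} : Finset ι).erase i := by
    ext k
    simp only [mem_erase, mem_filter, mem_univ, true_and]
    have := hneg k
    grind
  replace hP := congrArg card hP
  replace hN := congrArg card hN
  simp only [card_erase_eq_ite, mem_filter, mem_univ, true_and] at hP hN
  have hcx := card_pos_add_card_neg hx
  have hcy := card_pos_add_card_neg hy
  obtain ⟨m, hm⟩ := heven
  have hxj' : 0 < x j := by
    by_contra h
    have h' : x j < 0 := lt_of_le_of_ne (not_lt.1 h) hxj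
    rw [if_neg h] at hP
    rw [if_pos h'] at hN
    split_ifs at hP hN <;> omega
  have hyi' : y i < 0 := by
    by_contra h
    have h' : 0 < y i := lt_of_le_of_ne (not_lt.1 h) hyi.symm
    rw [if_pos h'] at hP
    rw [if_neg h] at hN
    split_ifs at hP hN <;> omega
  rw [if_pos hxj', if_neg hyi'.not_gt] at hP
  rw [if_neg hxj'.not_gt, if_pos hyi'] at hN
  refine ⟨by omega, by omega, by omega, by omega, fun k hk => ?_, fun k hk => ?_⟩
  · simp only [Set.mem_ofPred_eq] at hk ⊢
    refine (hneg k ?_ ?_).1 hk <;> rintro rfl <;> linarith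
  · simp only [Set.mem_ofPred_eq] at hk ⊢
    refine (hpos k ?_ ?_).2 hk <;> rintro rfl <;> linarith

/-- The linear dependencies of a family of points with coefficient sum zero. -/
def affineDependencies {ι V : Type*} [Fintype ι] [AddCommGroup V] [Module ℝ V] (A : ι → V) :
    Submodule ℝ (ι → ℝ) :=
  LinearMap.ker ((Fintype.linearCombination ℝ A).prod
    (Fintype.linearCombination ℝ fun _ => (1 : ℝ)))

theorem mem_affineDependencies {ι V : Type*} [Fintype ι] [AddCommGroup V] [Module ℝ V] {A : ι → V}
    {x : ι → ℝ} : x ∈ affineDependencies A ↔ ∑ i, x i • A i = 0 ∧ ∑ i, x i = 0 := by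
  simp [affineDependencies, Fintype.linearCombination_apply]

theorem exists_mem_affineDependencies_apply_eq_zero {ι V : Type*} [Fintype ι] [AddCommGroup V]
    [Module ℝ V] [FiniteDimensional ℝ V] (A : ι → V)
    (hcard : Module.finrank ℝ V + 2 < Fintype.card ι) (i : ι) :
    ∃ x ∈ affineDependencies A, x ≠ 0 ∧ x i = 0 := by
  have hker := LinearMap.ker_ne_bot_of_finrank_lt
    (f := ((Fintype.linearCombination ℝ A).prod
      (Fintype.linearCombination ℝ fun _ => (1 : ℝ))).prod (LinearMap.proj i))
    (by simpa using hcard)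
  obtain ⟨x, hx, hx0⟩ := Submodule.exists_mem_ne_zero_of_ne_bot hker
  rw [LinearMap.ker_prod] at hx
  exact ⟨x, hx.1, hx0, hx.2⟩

/-- For `n + 3` points in general position in `ℝⁿ`, a nonzero affine dependency has at most one
zero coefficient. -/
theorem eq_of_affineDependencies_apply_eq_zero {n : ℕ} {V : Type*} [AddCommGroup V] [Module ℝ V]
    {A : Fin (n + 3) → V}
    (hgen : ∀ s : Finset (Fin (n + 3)), s.card = n + 1 →
      AffineIndependent ℝ (fun i : s => A i))
    {x : Fin (n + 3) → ℝ} (hx : x ∈ affineDependencies A) (hx0 : x ≠ 0) {i j : Fin (n + 3)}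
    (hi : x i = 0) (hj : x j = 0) : i = j := by
  by_contra hij
  obtain ⟨hA, h1⟩ := mem_affineDependencies.1 hx
  set s : Finset (Fin (n + 3)) := {i, j}ᶜ with hs
  have hout (k) (hk : k ∉ s) : x k = 0 := by
    simp only [hs, Finset.mem_compl, Finset.mem_insert, Finset.mem_singleton, not_not] at hk
    rcases hk with rfl | rfl <;> assumption
  have hcard : s.card = n + 1 := by
    rw [hs, Finset.card_compl, Finset.card_pair hij, Fintype.card_fin]
    omega
  have hzero := affineIndependent_iff.1 (hgen s hcard) Finset.univ (fun k => x k)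
    (by
      rw [Finset.sum_coe_sort s x, Finset.sum_subset s.subset_univ fun k _ hk => hout k hk, h1])
    (by
      rw [Finset.sum_coe_sort s fun k => x k • A k,
        Finset.sum_subset s.subset_univ fun k _ hk => by rw [hout k hk, zero_smul], hA])
  refine hx0 (funext fun k => ?_)
  by_cases hk : k ∈ s
  · exact hzero ⟨k, hk⟩ (Finset.mem_univ _)
  · exact hout k hk

/-- Odd case: for `n + 3` points in general position in ℝⁿ with `n` odd, there
are nonzero solutions `x¹, x²` of the system `∑ xᵢ Aᵢ = 0`, `∑ xᵢ = 0` such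
that `x¹` has exactly `(n + 3) / 2` positive and `(n + 1) / 2` negative
coordinates, `x²` has exactly `(n + 1) / 2` positive and `(n + 3) / 2` negative
coordinates, the negative support of `x¹` is contained in that of `x²`, and the
positive support of `x²` is contained in that of `x¹`. -/
theorem exists_adjacent_solutions_odd
    (n : ℕ) (hn : 0 < n) (hodd : Odd n)
    (A : Fin (n + 3) → EuclideanSpace ℝ (Fin n))
    (hgen : ∀ s : Finset (Fin (n + 3)), s.card = n + 1 →
      AffineIndependent ℝ (fun i : s => A i)) :
    ∃ x₁ x₂ : Fin (n + 3) → ℝ, x₁ ≠ 0 ∧ x₂ ≠ 0 ∧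
      (∑ i, x₁ i • A i = 0) ∧ (∑ i, x₁ i = 0) ∧
      (∑ i, x₂ i • A i = 0) ∧ (∑ i, x₂ i = 0) ∧
      (Finset.univ.filter fun i => 0 < x₁ i).card = (n + 3) / 2 ∧
      (Finset.univ.filter fun i => x₁ i < 0).card = (n + 1) / 2 ∧
      (Finset.univ.filter fun i => 0 < x₂ i).card = (n + 1) / 2 ∧
      (Finset.univ.filter fun i => x₂ i < 0).card = (n + 3) / 2 ∧
      {i | x₁ i < 0} ⊆ {i | x₂ i < 0} ∧
      {i | 0 < x₂ i} ⊆ {i | 0 < x₁ i} := by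
  have heven : Even (Fintype.card (Fin (n + 3))) := by
    rw [Fintype.card_fin]
    exact hodd.add_odd (by decide)
  have hK : ∀ x ∈ affineDependencies A, x ≠ 0 → ∀ i j, x i = 0 → x j = 0 → i = j :=
    fun x hx hx0 i j => eq_of_affineDependencies_apply_eq_zero hgen hx hx0
  have hex (i) : ∃ x ∈ affineDependencies A, x ≠ 0 ∧ x i = 0 ∧
      (Finset.univ.filter fun k => x k < 0).card < (Finset.univ.filter fun k => 0 < x k).card := by
    obtain ⟨x, hx, hx0, hxi⟩ := exists_mem_affineDependencies_apply_eq_zero A (by simp) i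
    have hcard := card_pos_add_card_neg (x := x) (i := i)
      fun k => ⟨fun h => hK x hx hx0 k i h hxi, fun h => h ▸ hxi⟩
    rcases lt_trichotomy (Finset.univ.filter fun k => x k < 0).card
      (Finset.univ.filter fun k => 0 < x k).card with h | h | h
    · exact ⟨x, hx, hx0, hxi, h⟩
    · rw [h] at hcard
      obtain ⟨m, hm⟩ := heven
      omega
    · exact ⟨-x, neg_mem hx, neg_ne_zero.2 hx0, by simp [hxi], by simpa using h⟩
  obtain ⟨u, hu, hu0, hui, hus⟩ := hex 0
  obtain ⟨v, hv, hv0, hvj, hvs⟩ := hex 1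
  obtain ⟨x, hx, y, hy, i, j, hx0, hy0, hij, hxi, hyj, hxs, hys, hxy⟩ :=
    exists_sign_compatible_pair _ hK heven hu (neg_mem hv) hu0 (neg_ne_zero.2 hv0)
      (i := 0) (j := 1) (by simp) hui (by simp [hvj]) hus (by simpa using hvs)
  obtain ⟨h₁, h₂, h₃, h₄, h₅, h₆⟩ := card_signs_of_sign_compatible heven hij
    (fun k => ⟨fun h => hK x hx hx0 k i h hxi, fun h => h ▸ hxi⟩)
    (fun k => ⟨fun h => hK y hy hy0 k j h hyj, fun h => h ▸ hyj⟩) hxs hys hxy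
  rw [Fintype.card_fin] at h₁ h₂ h₃ h₄
  obtain ⟨hxA, hx1⟩ := mem_affineDependencies.1 hx
  obtain ⟨hyA, hy1⟩ := mem_affineDependencies.1 hy
  exact ⟨x, y, hx0, hy0, hxA, hx1, hyA, hy1, h₁, by omega, by omega, h₄, h₅, h₆⟩
end

section
/- Let n be an odd positive integer and let Δ and Δ′ be two ((n+1)/2)-dimensional simplices in ℝⁿ (each the convex hull of (n+3)/2 affinely independent points) whose n+3 vertices together are in general position. Then Δ and Δ′ are linked (i.e., the intrinsic frontier of Δ intersects the intrinsic interior of Δ′ in exactly one point) if and only if the intersection Δ ∩ Δ′ is a segment [p, q] with p ≠ q such that p lies in the intrinsic interior of Δ and in the intrinsic frontier of Δ′, while q lies in the intrinsic interior of Δ′ and in the intrinsic frontier of Δ. -/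
section Barycentric

variable {ι V : Type*} [Fintype ι] [NormedAddCommGroup V] [NormedSpace ℝ V]

theorem mem_convexHull_range_iff_exists_weights {p : ι → V} {x : V} :
    x ∈ convexHull ℝ (Set.range p) ↔
      ∃ w : ι → ℝ, (∀ i, 0 ≤ w i) ∧ ∑ i, w i = 1 ∧ ∑ i, w i • p i = x := by
  classical
  have h : Set.range p =
      Fintype.linearCombination ℝ p '' Set.range fun i : ι => (Pi.single i 1 : ι → ℝ) := by
    rw [← Set.range_comp]
    congr 1
    ext i
    simp
  rw [h, ← LinearMap.image_convexHull, convexHull_rangle_single_eq_stdSimplex]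
  simp [stdSimplex, Fintype.linearCombination_apply, and_assoc]

theorem AffineIndependent.weights_eq_of_sum_smul_eq {p : ι → V} (hp : AffineIndependent ℝ p)
    {v w : ι → ℝ} (hv : ∑ i, v i = 1) (hw : ∑ i, w i = 1)
    (h : ∑ i, v i • p i = ∑ i, w i • p i) : v = w := by
  refine (affineIndependent_iff_eq_of_fintype_affineCombination_eq ℝ p).1 hp v w hv hw ?_
  rwa [Finset.affineCombination_eq_linear_combination _ _ _ hv,
    Finset.affineCombination_eq_linear_combination _ _ _ hw]

variable {p : ι → V} {w : ι → ℝ}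

theorem AffineIndependent.sum_smul_mem_convexHull_iff (hp : AffineIndependent ℝ p)
    (hw : ∑ i, w i = 1) :
    ∑ i, w i • p i ∈ convexHull ℝ (Set.range p) ↔ ∀ i, 0 ≤ w i := by
  rw [mem_convexHull_range_iff_exists_weights]
  refine ⟨?_, fun h => ⟨w, h, hw, rfl⟩⟩
  rintro ⟨v, hv0, hv, h⟩
  rwa [← hp.weights_eq_of_sum_smul_eq hv hw h]

theorem AffineBasis.interior_nonneg_coord {W P : Type*} [NormedAddCommGroup W] [NormedSpace ℝ W]
    [MetricSpace P] [NormedAddTorsor W P] (b : AffineBasis ι ℝ P) :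
    interior {x | ∀ i, 0 ≤ b.coord i x} = {x | ∀ i, 0 < b.coord i x} := by
  cases subsingleton_or_nontrivial ι
  · simp
  · have : FiniteDimensional ℝ W := b.finiteDimensional
    have h : {x | ∀ i, 0 ≤ b.coord i x} = ⋂ i, b.coord i ⁻¹' Set.Ici 0 := by
      ext
      simp
    ext
    simp only [h, interior_iInter_of_finite, ←
      IsOpenMap.preimage_interior_eq_interior_preimage (isOpenMap_barycentric_coord b _)
        (continuous_barycentric_coord b _), interior_Ici]
    simp

theorem AffineIndependent.sum_smul_mem_intrinsicInterior_iff (hp : AffineIndependent ℝ p)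
    (hw : ∑ i, w i = 1) :
    ∑ i, w i • p i ∈ intrinsicInterior ℝ (convexHull ℝ (Set.range p)) ↔ ∀ i, 0 < w i := by
  have : Nonempty ι := by
    by_contra h
    simp [not_nonempty_iff.1 h] at hw
  rw [intrinsicInterior, affineSpan_convexHull]
  let A := affineSpan ℝ (Set.range p)
  let q : ι → A := fun i => ⟨p i, subset_affineSpan ℝ _ ⟨i, rfl⟩⟩
  have hq : AffineIndependent ℝ q := .of_comp A.subtype hp
  have hrange : ((↑) : A → V) ⁻¹' Set.range p = Set.range q := by
    ext x
    simp [q, Subtype.ext_iff]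
  let b : AffineBasis ι ℝ A :=
    ⟨q, hq, by rw [← hrange]; exact affineSpan_coe_preimage_eq_top (Set.range p)⟩
  have hcoe (x : A) : ∑ i, b.coord i x • p i = x := by
    have h := congrArg A.subtype (b.affineCombination_coord_eq_self x)
    rwa [Finset.map_affineCombination _ _ _ (b.sum_coord_apply_eq_one x),
      Finset.affineCombination_eq_linear_combination _ _ _ (b.sum_coord_apply_eq_one x)] at h
  have hpre : ((↑) : A → V) ⁻¹' convexHull ℝ (Set.range p) = {x | ∀ i, 0 ≤ b.coord i x} := by
    ext x
    rw [Set.mem_preimage, ← hcoe x, hp.sum_smul_mem_convexHull_iff (b.sum_coord_apply_eq_one x)]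
    simp
  change _ ∈ ((↑) : A → V) '' interior (((↑) : A → V) ⁻¹' _) ↔ _
  rw [hpre, b.interior_nonneg_coord]
  constructor
  · rintro ⟨x, hx, hxw⟩
    rw [← hcoe x] at hxw
    rw [← hp.weights_eq_of_sum_smul_eq (b.sum_coord_apply_eq_one x) hw hxw]
    exact hx
  · intro h
    have hmem : ∑ i, w i • p i ∈ A := by
      rw [← Finset.affineCombination_eq_linear_combination _ _ _ hw]
      exact affineCombination_mem_affineSpan hw p
    refine ⟨⟨_, hmem⟩, fun i => ?_, rfl⟩
    rw [congrFun (hp.weights_eq_of_sum_smul_eq (b.sum_coord_apply_eq_one _) hw (hcoe ⟨_, hmem⟩)) i]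
    exact h i

theorem intrinsicFrontier_convexHull_range (p : ι → V) :
    intrinsicFrontier ℝ (convexHull ℝ (Set.range p)) =
      convexHull ℝ (Set.range p) \ intrinsicInterior ℝ (convexHull ℝ (Set.range p)) := by
  rw [← intrinsicClosure_sdiff_intrinsicInterior, IsClosed.intrinsicClosure]
  exact ((Set.finite_range p).isClosed_convexHull ℝ).preimage continuous_subtype_val

theorem AffineIndependent.sum_smul_mem_intrinsicFrontier_iff (hp : AffineIndependent ℝ p)
    (hw : ∑ i, w i = 1) :
    ∑ i, w i • p i ∈ intrinsicFrontier ℝ (convexHull ℝ (Set.range p)) ↔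
      (∀ i, 0 ≤ w i) ∧ ∃ i, w i = 0 := by
  rw [intrinsicFrontier_convexHull_range, Set.mem_sdiff, hp.sum_smul_mem_convexHull_iff hw,
    hp.sum_smul_mem_intrinsicInterior_iff hw]
  refine and_congr_right fun h => ?_
  push Not
  exact exists_congr fun i => ⟨fun hi => hi.antisymm (h i), fun hi => hi.le⟩

theorem AffineIndependent.openSegment_subset_intrinsicInterior (hp : AffineIndependent ℝ p)
    {x y : V} (hx : x ∈ intrinsicInterior ℝ (convexHull ℝ (Set.range p)))
    (hy : y ∈ convexHull ℝ (Set.range p)) :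
    openSegment ℝ x y ⊆ intrinsicInterior ℝ (convexHull ℝ (Set.range p)) := by
  obtain ⟨u, -, hu, rfl⟩ := mem_convexHull_range_iff_exists_weights.1 (intrinsicInterior_subset hx)
  obtain ⟨v, hv0, hv, rfl⟩ := mem_convexHull_range_iff_exists_weights.1 hy
  rw [hp.sum_smul_mem_intrinsicInterior_iff hu] at hx
  rintro _ ⟨s, t, hs, ht, hst, rfl⟩
  have h : s • ∑ i, u i • p i + t • ∑ i, v i • p i = ∑ i, (s * u i + t * v i) • p i := by
    simp only [Finset.smul_sum, smul_smul, add_smul, Finset.sum_add_distrib]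
  rw [h, hp.sum_smul_mem_intrinsicInterior_iff]
  · exact fun i => add_pos_of_pos_of_nonneg (mul_pos hs (hx i)) (mul_nonneg ht.le (hv0 i))
  · rw [Finset.sum_add_distrib, ← Finset.mul_sum, ← Finset.mul_sum, hu, hv, mul_one, mul_one, hst]

end Barycentric

theorem exists_pos_forall_mem_Icc_of_nonneg_add_mul {J : Type*} [Fintype J] {c d : J → ℝ} {j₀ : J}
    (hc₀ : c j₀ = 0) (hc : ∀ j, j ≠ j₀ → 0 < c j) (hd₀ : 0 < d j₀) (hd : ∃ j, d j < 0) :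
    ∃ T > 0, (∀ j, 0 ≤ c j + T * d j) ∧ (∃ j, c j + T * d j = 0) ∧
      ∀ t, (∀ j, 0 ≤ c j + t * d j) → t ∈ Set.Icc 0 T := by
  classical
  obtain ⟨k, hk⟩ := hd
  obtain ⟨m, hm, hmin⟩ := (Finset.univ.filter fun j => d j < 0).exists_min_image
    (fun j => c j / -d j) ⟨k, by simpa using hk⟩
  simp only [Finset.mem_filter, Finset.mem_univ, true_and] at hm hmin
  have hpos : 0 < c m / -d m := div_pos (hc m (by rintro rfl; linarith)) (by linarith)
  refine ⟨c m / -d m, hpos, fun j => ?_, ⟨m, by have := hm.ne; field_simp; ring⟩, fun t ht => ⟨?_, ?_⟩⟩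
  · rcases lt_or_ge (d j) 0 with hj | hj
    · have h := hmin j hj
      rw [le_div_iff₀ (by linarith)] at h
      linarith
    · have : 0 ≤ c j := by
        by_cases h : j = j₀
        · exact (h ▸ hc₀).ge
        · exact (hc j h).le
      positivity
  · have h := ht j₀
    rw [hc₀, zero_add] at h
    exact nonneg_of_mul_nonneg_left h hd₀
  · rw [le_div_iff₀ (by linarith)]
    linarith [ht m]

section Linking

variable {ι κ V : Type*} [Fintype ι] [Fintype κ] [NormedAddCommGroup V] [NormedSpace ℝ V]

/-- The linear relations `∑ i, c (inl i) • P i = ∑ j, c (inr j) • Q j` whose two sides have the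
same total weight. -/
def balancedRelations (P : ι → V) (Q : κ → V) : Submodule ℝ (ι ⊕ κ → ℝ) :=
  LinearMap.ker ((Fintype.linearCombination ℝ (Sum.elim P (-Q))).prod
    (Fintype.linearCombination ℝ (Sum.elim (1 : ι → ℝ) (-1 : κ → ℝ))))

theorem mem_balancedRelations {P : ι → V} {Q : κ → V} {c : ι ⊕ κ → ℝ} :
    c ∈ balancedRelations P Q ↔
      ∑ i, c (.inl i) • P i = ∑ j, c (.inr j) • Q j ∧
        ∑ i, c (.inl i) = ∑ j, c (.inr j) := by
  simp [balancedRelations, Fintype.linearCombination_apply, Fintype.sum_sum_type,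
    ← sub_eq_add_neg, sub_eq_zero]

theorem eq_zero_of_mem_balancedRelations {P : ι → V} {Q : κ → V} {s : Finset (ι ⊕ κ)}
    (hs : AffineIndependent ℝ fun i : s => Sum.elim P Q i) {c : ι ⊕ κ → ℝ}
    (hc : c ∈ balancedRelations P Q) (hcs : ∀ j, j ∉ s → c j = 0) : c = 0 := by
  classical
  obtain ⟨h₁, h₂⟩ := mem_balancedRelations.1 hc
  let w : ι ⊕ κ → ℝ := Sum.elim (fun i => c (.inl i)) (fun j => -c (.inr j))
  have hws : ∀ j, j ∉ s → w j = 0 := by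
    rintro (i | j) h <;> simp [w, hcs _ h]
  have hw₁ : ∑ j : s, w j • Sum.elim P Q j = 0 := by
    rw [Finset.sum_coe_sort s fun j => w j • Sum.elim P Q j,
      Finset.sum_subset (Finset.subset_univ s) fun j _ h => by rw [hws j h, zero_smul]]
    simp [w, Fintype.sum_sum_type, h₁]
  have hw₂ : ∑ j : s, w j = 0 := by
    rw [Finset.sum_coe_sort s w, Finset.sum_subset (Finset.subset_univ s) fun j _ h => hws j h]
    simp [w, Fintype.sum_sum_type, h₂]
  have hw := affineIndependent_iff.1 hs Finset.univ (fun j => w j) hw₂ hw₁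
  ext j
  by_cases hj : j ∈ s
  · have h := hw ⟨j, hj⟩ (Finset.mem_univ _)
    rcases j with i | j
    · simpa [w] using h
    · simpa [w] using h
  · exact hcs j hj

theorem exists_ne_zero_mem_balancedRelations [FiniteDimensional ℝ V] (P : ι → V) (Q : κ → V)
    (h : Module.finrank ℝ V + 2 < Fintype.card ι + Fintype.card κ) :
    ∃ d ∈ balancedRelations P Q, ∑ i, d (.inl i) = 0 ∧ d ≠ 0 := by
  let f := ((Fintype.linearCombination ℝ (Sum.elim P (-Q))).prod
    (Fintype.linearCombination ℝ (Sum.elim (1 : ι → ℝ) (-1 : κ → ℝ)))).prod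
    (Fintype.linearCombination ℝ (Sum.elim (1 : ι → ℝ) (0 : κ → ℝ)))
  have hf : LinearMap.ker f ≠ ⊥ := LinearMap.ker_ne_bot_of_finrank_lt (by simpa using h)
  obtain ⟨d, hd, hd0⟩ := (Submodule.ne_bot_iff _).1 hf
  rw [LinearMap.ker_prod] at hd
  refine ⟨d, hd.1, ?_, hd0⟩
  simpa [Fintype.linearCombination_apply, Fintype.sum_sum_type] using hd.2

/-- A pair of families is in relative general position if every balanced relation that vanishes
at two distinct vertices is trivial. -/
def RelationsGeneric (P : ι → V) (Q : κ → V) : Prop :=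
  ∀ c ∈ balancedRelations P Q, ∀ j k, j ≠ k → c j = 0 → c k = 0 → c = 0

variable {P : ι → V} {Q : κ → V}

theorem RelationsGeneric.eq_zero (hgen : RelationsGeneric P Q) {c d : ι ⊕ κ → ℝ}
    (hc : c ∈ balancedRelations P Q) (hcs : ∑ i, c (.inl i) = 1)
    (hd : d ∈ balancedRelations P Q) (hds : ∑ i, d (.inl i) = 0)
    {j : ι ⊕ κ} (hcj : c j = 0) (hdj : d j = 0) : d = 0 := by
  have hc0 : c ≠ 0 := by
    rintro rfl
    simp at hcs
  obtain ⟨k, hk⟩ := Function.ne_iff.1 hc0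
  have hjk : j ≠ k := by
    rintro rfl
    exact hk hcj
  have h := hgen (d - (d k / c k) • c) (sub_mem hd (Submodule.smul_mem _ _ hc)) j k hjk
    (by simp [hcj, hdj]) (by simp [div_mul_cancel₀ _ hk])
  rw [sub_eq_zero] at h
  have hr : d k / c k = 0 := by
    rw [h] at hds
    simpa [← Finset.mul_sum, hcs] using hds
  rw [h, hr, zero_smul]

theorem exists_segment_of_linked [FiniteDimensional ℝ V]
    (hP : AffineIndependent ℝ P) (hQ : AffineIndependent ℝ Q)
    (hcard : Module.finrank ℝ V + 2 < Fintype.card ι + Fintype.card κ)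
    (hgen : RelationsGeneric P Q) {q : V}
    (hq : intrinsicFrontier ℝ (convexHull ℝ (Set.range P)) ∩
      intrinsicInterior ℝ (convexHull ℝ (Set.range Q)) = {q}) :
    ∃ p, p ≠ q ∧
      convexHull ℝ (Set.range P) ∩ convexHull ℝ (Set.range Q) = segment ℝ p q ∧
      p ∈ intrinsicInterior ℝ (convexHull ℝ (Set.range P)) ∧
      p ∈ intrinsicFrontier ℝ (convexHull ℝ (Set.range Q)) := by
  obtain ⟨hqP, hqQ⟩ : q ∈ intrinsicFrontier ℝ (convexHull ℝ (Set.range P)) ∩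
      intrinsicInterior ℝ (convexHull ℝ (Set.range Q)) := hq ▸ rfl
  have coords {x : V} (hxP : x ∈ convexHull ℝ (Set.range P))
      (hxQ : x ∈ convexHull ℝ (Set.range Q)) :
      ∃ e ∈ balancedRelations P Q, (∀ j, 0 ≤ e j) ∧ ∑ i, e (.inl i) = 1 ∧
        ∑ i, e (.inl i) • P i = x := by
    obtain ⟨u, hu0, hu, hux⟩ := mem_convexHull_range_iff_exists_weights.1 hxP
    obtain ⟨v, hv0, hv, hvx⟩ := mem_convexHull_range_iff_exists_weights.1 hxQ
    refine ⟨Sum.elim u v, mem_balancedRelations.2 ?_, ?_, ?_⟩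
    · simp [hux, hvx, hu, hv]
    · rintro (i | j)
      · exact hu0 i
      · exact hv0 j
    · simp [hu, hux]
  have pos_of_ne {e : ι ⊕ κ → ℝ} (he : e ∈ balancedRelations P Q) (he0 : ∀ j, 0 ≤ e j)
      (hes : ∑ i, e (.inl i) = 1) {j k : ι ⊕ κ} (hj : e j = 0) (hk : k ≠ j) : 0 < e k := by
    refine (he0 k).lt_of_ne fun hk0 => ?_
    simp [hgen e he k j hk hk0.symm hj] at hes
  obtain ⟨c, hc, hc0, hcs, rfl⟩ := coords (by
    rw [intrinsicFrontier_convexHull_range] at hqP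
    exact hqP.1) (intrinsicInterior_subset hqQ)
  obtain ⟨-, i₀, hi₀⟩ := (hP.sum_smul_mem_intrinsicFrontier_iff hcs).1 hqP
  obtain ⟨d, hd, hds, hdi₀⟩ : ∃ d ∈ balancedRelations P Q,
      ∑ i, d (.inl i) = 0 ∧ 0 < d (.inl i₀) := by
    obtain ⟨d, hd, hds, hd0⟩ := exists_ne_zero_mem_balancedRelations P Q hcard
    rcases lt_trichotomy (d (.inl i₀)) 0 with h | h | h
    · exact ⟨-d, neg_mem hd, by simp [hds], by simpa using h⟩
    · exact absurd (hgen.eq_zero hc hcs hd hds hi₀ h) hd0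
    · exact ⟨d, hd, hds, h⟩
  have hdneg : ∃ j, d j < 0 := by
    by_contra! h
    linarith [(Finset.sum_eq_zero_iff_of_nonneg fun i _ => h (.inl i)).1 hds i₀ (Finset.mem_univ _)]
  obtain ⟨T, hT, hT0, ⟨k, hk⟩, hTmax⟩ := exists_pos_forall_mem_Icc_of_nonneg_add_mul hi₀
    (fun j hj => pos_of_ne hc hc0 hcs hi₀ hj) hdi₀ hdneg
  have hmem (t : ℝ) : c + t • d ∈ balancedRelations P Q := add_mem hc (Submodule.smul_mem _ _ hd)
  have hsum (t : ℝ) : ∑ i, (c + t • d) (.inl i) = 1 := by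
    simp [Finset.sum_add_distrib, ← Finset.mul_sum, hcs, hds]
  have hpoint (t : ℝ) : ∑ i, (c + t • d) (.inl i) • P i =
      ∑ i, c (.inl i) • P i + t • ∑ i, d (.inl i) • P i := by
    simp only [Pi.add_apply, Pi.smul_apply, smul_eq_mul, add_smul, mul_smul,
      Finset.sum_add_distrib, Finset.smul_sum]
  set c' := c + T • d with hc'
  have hne : ∑ i, c' (.inl i) • P i ≠ ∑ i, c (.inl i) • P i := by
    intro h
    have h := congrFun (hP.weights_eq_of_sum_smul_eq (hsum T) hcs h) i₀
    have : T * d (.inl i₀) = 0 := by simpa [hc'] using h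
    exact (mul_pos hT hdi₀).ne' this
  have hsum' : ∑ j, c' (.inr j) = 1 := (mem_balancedRelations.1 (hmem T)).2 ▸ hsum T
  have hQpoint := (mem_balancedRelations.1 (hmem T)).1
  obtain ⟨j₁, rfl⟩ : ∃ j, k = .inr j := by
    rcases k with i | j
    · refine absurd ?_ hne
      rw [← Set.mem_singleton_iff, ← hq]
      refine ⟨(hP.sum_smul_mem_intrinsicFrontier_iff (hsum T)).2 ⟨fun i => hT0 _, i, hk⟩, ?_⟩
      rw [hQpoint, hQ.sum_smul_mem_intrinsicInterior_iff hsum']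
      exact fun j => pos_of_ne (hmem T) hT0 (hsum T) hk (by simp)
    · exact ⟨j, rfl⟩
  have hpP : ∑ i, c' (.inl i) • P i ∈ intrinsicInterior ℝ (convexHull ℝ (Set.range P)) :=
    (hP.sum_smul_mem_intrinsicInterior_iff (hsum T)).2
      fun i => pos_of_ne (hmem T) hT0 (hsum T) hk (by simp)
  have hpQ : ∑ i, c' (.inl i) • P i ∈ intrinsicFrontier ℝ (convexHull ℝ (Set.range Q)) := by
    rw [hQpoint, hQ.sum_smul_mem_intrinsicFrontier_iff hsum']
    exact ⟨fun j => hT0 _, j₁, hk⟩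
  refine ⟨_, hne, Set.Subset.antisymm ?_ ?_, hpP, hpQ⟩
  · rintro x ⟨hxP, hxQ⟩
    obtain ⟨e, he, he0, hes, rfl⟩ := coords hxP hxQ
    obtain ⟨t, rfl⟩ : ∃ t : ℝ, e = c + t • d := by
      refine ⟨e (.inl i₀) / d (.inl i₀), ?_⟩
      rw [← sub_eq_zero]
      refine hgen.eq_zero hc hcs (sub_mem he (hmem _)) ?_ hi₀ ?_
      · simp only [Pi.sub_apply, Finset.sum_sub_distrib, hsum, hes, sub_self]
      · simp [hi₀, div_mul_cancel₀ _ hdi₀.ne']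
    obtain ⟨ht0, htT⟩ := hTmax t he0
    refine ⟨t / T, 1 - t / T, by positivity, sub_nonneg.2 ((div_le_one hT).2 htT), by ring, ?_⟩
    rw [hpoint, hpoint, smul_add, smul_smul, div_mul_cancel₀ _ hT.ne']
    module
  · have hconv := (convex_convexHull ℝ (Set.range P)).inter (convex_convexHull ℝ (Set.range Q))
    refine hconv.segment_subset ⟨intrinsicInterior_subset hpP, ?_⟩
      ⟨?_, intrinsicInterior_subset hqQ⟩
    · exact intrinsicFrontier_subset ((Set.finite_range Q).isClosed_convexHull ℝ) hpQ
    · exact intrinsicFrontier_subset ((Set.finite_range P).isClosed_convexHull ℝ) hqP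

omit [Fintype κ] in
theorem linked_of_inter_eq_segment (hP : AffineIndependent ℝ P) {p q : V}
    (hpq : convexHull ℝ (Set.range P) ∩ convexHull ℝ (Set.range Q) = segment ℝ p q)
    (hp : p ∈ intrinsicInterior ℝ (convexHull ℝ (Set.range P)))
    (hqQ : q ∈ intrinsicInterior ℝ (convexHull ℝ (Set.range Q)))
    (hqP : q ∈ intrinsicFrontier ℝ (convexHull ℝ (Set.range P))) :
    intrinsicFrontier ℝ (convexHull ℝ (Set.range P)) ∩
      intrinsicInterior ℝ (convexHull ℝ (Set.range Q)) = {q} := by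
  refine Set.Subset.antisymm ?_ (Set.singleton_subset_iff.2 ⟨hqP, hqQ⟩)
  rw [intrinsicFrontier_convexHull_range] at hqP ⊢
  rintro x ⟨⟨hxP, hxP'⟩, hxQ⟩
  have hx : x ∈ segment ℝ p q := hpq ▸ ⟨hxP, intrinsicInterior_subset hxQ⟩
  rw [← insert_endpoints_openSegment] at hx
  rcases hx with rfl | rfl | hx
  · exact absurd hp hxP'
  · rfl
  · exact absurd (hP.openSegment_subset_intrinsicInterior hp hqP.1 hx) hxP'

end Linking

/-- Characterization of linking: let `n` be odd and let `Δ`, `Δ′` be the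
`(n+1)/2`-dimensional simplices in ℝⁿ spanned by two affinely independent
families `P`, `Q` of `(n+3)/2` points each, all `n + 3` vertices together being
in general position. Then the intrinsic frontier of `Δ` meets the intrinsic
interior of `Δ′` in exactly one point iff `Δ ∩ Δ′` is a segment `[p, q]` with
`p ≠ q`, where `p` lies in the intrinsic interior of `Δ` and the intrinsic
frontier of `Δ′`, and `q` lies in the intrinsic interior of `Δ′` and the
intrinsic frontier of `Δ`. -/
theorem linked_iff_segment
    (n : ℕ) (hn : 0 < n) (hodd : Odd n)
    (P Q : Fin ((n + 3) / 2) → EuclideanSpace ℝ (Fin n))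
    (hP : AffineIndependent ℝ P) (hQ : AffineIndependent ℝ Q)
    (hgen : ∀ s : Finset (Fin ((n + 3) / 2) ⊕ Fin ((n + 3) / 2)),
      s.card = n + 1 → AffineIndependent ℝ (fun i : s => Sum.elim P Q i)) :
    (∃ p : EuclideanSpace ℝ (Fin n),
        intrinsicFrontier ℝ (convexHull ℝ (Set.range P)) ∩
          intrinsicInterior ℝ (convexHull ℝ (Set.range Q)) = {p}) ↔
    (∃ p q : EuclideanSpace ℝ (Fin n), p ≠ q ∧
        convexHull ℝ (Set.range P) ∩ convexHull ℝ (Set.range Q) = segment ℝ p q ∧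
        p ∈ intrinsicInterior ℝ (convexHull ℝ (Set.range P)) ∧
        p ∈ intrinsicFrontier ℝ (convexHull ℝ (Set.range Q)) ∧
        q ∈ intrinsicInterior ℝ (convexHull ℝ (Set.range Q)) ∧
        q ∈ intrinsicFrontier ℝ (convexHull ℝ (Set.range P))) := by
  have hk : (n + 3) / 2 + (n + 3) / 2 = n + 3 := by
    obtain ⟨m, rfl⟩ := hodd
    omega
  have hrel : RelationsGeneric P Q := by
    intro c hc j k hjk hj hk'
    refine eq_zero_of_mem_balancedRelations (hgen {j, k}ᶜ ?_) hc fun i hi => ?_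
    · rw [Finset.card_compl, Finset.card_pair hjk]
      simp [hk]
    · simp only [Finset.mem_compl, Finset.mem_insert, Finset.mem_singleton, not_not] at hi
      rcases hi with rfl | rfl <;> assumption
  constructor
  · rintro ⟨q, hq⟩
    obtain ⟨p, hne, hpq, hpP, hpQ⟩ :=
      exists_segment_of_linked hP hQ (by simp [hk]) hrel hq
    have hqmem := hq.ge (Set.mem_singleton q)
    exact ⟨p, q, hne, hpq, hpP, hpQ, hqmem.2, hqmem.1⟩
  · rintro ⟨p, q, -, hpq, hpP, -, hqQ, hqP⟩
    exact ⟨q, linked_of_inter_eq_segment hP hpq hpP hqQ hqP⟩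
end
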